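/- arXiv:2110.09346 — 2 statements merged into one kernel-verified Lean document; each statement's English description precedes it below -/
import Mathlib

section
/- Let G be a finite simple graph containing no subgraph isomorphic to the triangle K_3. Then every 4-cycle of G is a convex subgraph of G if and only if G contains no subgraph isomorphic to the complete bipartite graph K_{2,3}. -/
open SimpleGraph

/-- A walk-subgraph containment based notion of convexity: a subgraph `H` of `G` is convex
if for all vertices `u v` of `H`, every shortest path of `G` between `u` and `v`
is contained in `H`. -/
def IsConvexSubgraph {V : Type*} {G : SimpleGraph V} (H : G.Subgraph) : Prop :=
  ∀ ⦃u v : V⦄, u ∈ H.verts → v ∈ H.verts →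
    ∀ p : G.Walk u v, p.IsPath → p.length = G.dist u v → p.toSubgraph ≤ H

/-- `G` contains a subgraph isomorphic to `X` iff there is an injective map of vertices
preserving adjacency. -/
def HasSubgraphIsoTo {V W : Type*} (G : SimpleGraph V) (X : SimpleGraph W) : Prop :=
  ∃ f : W ↪ V, ∀ ⦃a b : W⦄, X.Adj a b → G.Adj (f a) (f b)

lemma cycleGraph_four_eq_or_adj_or_exists (i j : Fin 4) :
    i = j ∨ (cycleGraph 4).Adj i j ∨ ∃ x y, x ≠ y ∧ (cycleGraph 4).Adj i x ∧
      (cycleGraph 4).Adj x j ∧ (cycleGraph 4).Adj i y ∧ (cycleGraph 4).Adj y j := by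
  revert i j
  decide

/-- Two vertices of a square are equal, adjacent, or have two common neighbours in the square. -/
lemma eq_or_adj_or_exists_of_iso_cycleGraph_four {V : Type*} {G : SimpleGraph V} {C : G.Subgraph}
    (φ : C.coe ≃g cycleGraph 4) {u v : V} (hu : u ∈ C.verts) (hv : v ∈ C.verts) :
    u = v ∨ C.Adj u v ∨
      ∃ x y, x ≠ y ∧ C.Adj u x ∧ C.Adj x v ∧ C.Adj u y ∧ C.Adj y v := by
  have key (i j : Fin 4) (h : (cycleGraph 4).Adj i j) : C.Adj (φ.symm i) (φ.symm j) :=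
    φ.symm.map_rel_iff.2 h
  have hu' : ((φ.symm (φ ⟨u, hu⟩) : C.verts) : V) = u := by simp
  have hv' : ((φ.symm (φ ⟨v, hv⟩) : C.verts) : V) = v := by simp
  obtain h | h | ⟨x, y, hxy, h₁, h₂, h₃, h₄⟩ :=
    cycleGraph_four_eq_or_adj_or_exists (φ ⟨u, hu⟩) (φ ⟨v, hv⟩)
  · exact .inl (by rw [← hu', ← hv', h])
  · exact .inr (.inl (by simpa only [hu', hv'] using key _ _ h))
  · refine .inr (.inr ⟨φ.symm x, φ.symm y, fun h ↦ hxy (φ.symm.injective (Subtype.ext h)), ?_⟩)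
    have := key _ _ h₁
    have := key _ _ h₂
    have := key _ _ h₃
    have := key _ _ h₄
    simp_all only [and_self]

lemma hasSubgraphIsoTo_completeGraph_three {V : Type*} {G : SimpleGraph V} {a b c : V}
    (hab : G.Adj a b) (hbc : G.Adj b c) (hac : G.Adj a c) :
    HasSubgraphIsoTo G (completeGraph (Fin 3)) := by
  have hadj : ∀ i j : Fin 3, i ≠ j → G.Adj (![a, b, c] i) (![a, b, c] j) := by
    intro i j hij
    fin_cases i <;> fin_cases j <;>
      first | exact absurd rfl hij | simp [hab, hbc, hac, hab.symm, hbc.symm, hac.symm]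
  refine ⟨⟨![a, b, c], fun i j h ↦ ?_⟩, fun i j hij ↦ hadj i j hij⟩
  by_contra hij
  exact (hadj i j hij).ne h

lemma hasSubgraphIsoTo_completeBipartiteGraph_two_three {V : Type*} {G : SimpleGraph V}
    {a b x y z : V} (hab : a ≠ b) (hxy : x ≠ y) (hxz : x ≠ z) (hyz : y ≠ z)
    (hax : G.Adj a x) (hay : G.Adj a y) (haz : G.Adj a z)
    (hbx : G.Adj b x) (hby : G.Adj b y) (hbz : G.Adj b z) :
    HasSubgraphIsoTo G (completeBipartiteGraph (Fin 2) (Fin 3)) := by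
  have hadj : ∀ (i : Fin 2) (j : Fin 3), G.Adj (![a, b] i) (![x, y, z] j) := by
    intro i j
    fin_cases i <;> fin_cases j <;> assumption
  have hinj₁ : Function.Injective ![a, b] := by
    intro i j h
    fin_cases i <;> fin_cases j <;> simp_all
  have hinj₂ : Function.Injective ![x, y, z] := by
    intro i j h
    fin_cases i <;> fin_cases j <;> simp_all
  refine ⟨⟨Sum.elim ![a, b] ![x, y, z],
    hinj₁.sumElim hinj₂ fun i j ↦ (hadj i j).ne⟩, ?_⟩
  rintro (i | i) (j | j) h
  · simp at h
  · exact hadj i j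
  · exact (hadj j i).symm
  · simp at h

/-- A square through four given vertices, as a subgraph. -/
lemma exists_subgraph_iso_cycleGraph_four {V : Type*} {G : SimpleGraph V} {a b x y : V}
    (hab : a ≠ b) (hxy : x ≠ y)
    (hax : G.Adj a x) (hay : G.Adj a y) (hbx : G.Adj b x) (hby : G.Adj b y) :
    ∃ C : G.Subgraph, Nonempty (C.coe ≃g cycleGraph 4) ∧ C.verts = {a, x, b, y} := by
  have hadj : ∀ i j : Fin 4, (cycleGraph 4).Adj i j →
      G.Adj (![a, x, b, y] i) (![a, x, b, y] j) := by
    intro i j h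
    fin_cases i <;> fin_cases j <;>
      first
      | exact absurd h (by decide)
      | simp [hax, hay, hbx, hby, hax.symm, hay.symm, hbx.symm, hby.symm]
  have hinj : Function.Injective ![a, x, b, y] := by
    have := hax.ne
    have := hay.ne
    have := hbx.ne
    have := hby.ne
    intro i j h
    fin_cases i <;> fin_cases j <;> simp_all
  let f : Copy (cycleGraph 4) G := ⟨⟨![a, x, b, y], fun {i j} h ↦ hadj i j h⟩, hinj⟩
  refine ⟨f.toSubgraph, ⟨f.isoToSubgraph.symm⟩, ?_⟩
  have : f.toSubgraph.verts = Set.range ![a, x, b, y] := by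
    ext v
    simp [Copy.toSubgraph, f]
  rw [this]
  ext v
  simp [eq_comm, or_comm, or_left_comm]

theorem convex_squares_iff_K23_free {V : Type*} [Fintype V] (G : SimpleGraph V)
    (hK3 : ¬ HasSubgraphIsoTo G (completeGraph (Fin 3))) :
    (∀ C : G.Subgraph, Nonempty (C.coe ≃g cycleGraph 4) → IsConvexSubgraph C) ↔
      ¬ HasSubgraphIsoTo G (completeBipartiteGraph (Fin 2) (Fin 3)) := by
  have triangle {a b c : V} (hab : G.Adj a b) (hbc : G.Adj b c) : ¬ G.Adj a c :=
    fun hac ↦ hK3 (hasSubgraphIsoTo_completeGraph_three hab hbc hac)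
  constructor
  · rintro hconv ⟨f, hf⟩
    have hadj (i : Fin 2) (j : Fin 3) : G.Adj (f (.inl i)) (f (.inr j)) := hf (by simp)
    have hab : f (.inl 0) ≠ f (.inl 1) := f.injective.ne (by simp)
    obtain ⟨C, hC, hverts⟩ := exists_subgraph_iso_cycleGraph_four hab
      (f.injective.ne (by simp) : f (.inr 0) ≠ f (.inr 1))
      (hadj 0 0) (hadj 0 1) (hadj 1 0) (hadj 1 1)
    let p : G.Walk (f (.inl 0)) (f (.inl 1)) := .cons (hadj 0 2) (.cons (hadj 1 2).symm .nil)
    have hlen : p.length = G.dist (f (.inl 0)) (f (.inl 1)) := by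
      refine le_antisymm ?_ (dist_le p)
      have h0 := p.reachable.pos_dist_of_ne hab
      have h1 : G.dist (f (.inl 0)) (f (.inl 1)) ≠ 1 := fun h ↦
        triangle (hadj 0 0) (hadj 1 0).symm (dist_eq_one_iff_adj.1 h)
      change 2 ≤ _
      omega
    have hle := hconv C hC (by simp [hverts]) (by simp [hverts]) p
      (p.isPath_of_length_eq_dist hlen) hlen
    have hz : f (.inr 2) ∈ C.verts := hle.1 (by simp [p])
    simp [hverts] at hz
  · rintro hK23 C ⟨φ⟩ u v hu hv p - hlen
    have hcases := eq_or_adj_or_exists_of_iso_cycleGraph_four φ hu hv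
    match p with
    | .nil => simpa using hu
    | .cons h .nil =>
      obtain rfl | h' | ⟨x, -, -, h₁, h₂, -⟩ := hcases
      · exact absurd rfl h.ne
      · simpa using subgraphOfAdj_le_of_adj C h'
      · exact absurd h (triangle h₁.adj_sub h₂.adj_sub)
    | .cons (v := w) h (.cons h' .nil) =>
      obtain rfl | h'' | ⟨x, y, hxy, h₁, h₂, h₃, h₄⟩ := hcases
      · simp at hlen
      · exact absurd h''.adj_sub (triangle h h')
      · have huv : u ≠ v := by
          rintro rfl
          simp at hlen
        have hw : C.Adj u w ∧ C.Adj w v := by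
          by_cases hxw : x = w
          · exact hxw ▸ ⟨h₁, h₂⟩
          by_cases hyw : y = w
          · exact hyw ▸ ⟨h₃, h₄⟩
          exact absurd (hasSubgraphIsoTo_completeBipartiteGraph_two_three huv hxy hxw hyw
            h₁.adj_sub h₃.adj_sub h h₂.adj_sub.symm h₄.adj_sub.symm h'.symm) hK23
        simpa using hw
    | .cons h (.cons h' (.cons h'' q)) =>
      simp only [Walk.length_cons] at hlen
      obtain rfl | h' | ⟨x, -, -, h₁, h₂, -⟩ := hcases
      · simp at hlen
      · have := dist_eq_one_iff_adj.2 h'.adj_sub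
        omega
      · have := dist_le (.cons h₁.adj_sub (.cons h₂.adj_sub .nil))
        simp only [Walk.length_cons, Walk.length_nil] at this
        omega
end

section
/- Every 4-cycle of a median graph G is a convex subgraph of G. -/
open SimpleGraph

/-- `x` is a median of the vertices `u`, `v`, `w` in `G`. -/
def IsMedianVertex {V : Type*} (G : SimpleGraph V) (u v w x : V) : Prop :=
  G.dist u x + G.dist x v = G.dist u v ∧
  G.dist v x + G.dist x w = G.dist v w ∧
  G.dist u x + G.dist x w = G.dist u w

/-- A median graph: a connected graph in which every triple of vertices has a
unique median. -/
def IsMedianGraph {V : Type*} (G : SimpleGraph V) : Prop :=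
  G.Connected ∧ ∀ u v w : V, ∃! x : V, IsMedianVertex G u v w x

namespace IsMedianGraph

variable {V : Type*} {G : SimpleGraph V}

/-- A median graph contains no triangle. -/
theorem not_adj_of_adj_of_adj (hG : IsMedianGraph G) {x y z : V} (hxy : G.Adj x y)
    (hyz : G.Adj y z) : ¬ G.Adj x z := by
  intro hxz
  obtain ⟨m, ⟨h₁, h₂, h₃⟩, -⟩ := hG.2 x y z
  rw [dist_eq_one_iff_adj.mpr hxy] at h₁
  rw [dist_eq_one_iff_adj.mpr hyz] at h₂
  rw [dist_eq_one_iff_adj.mpr hxz] at h₃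
  rw [G.dist_comm (u := m) (v := y)] at h₁
  omega

/-- In a median graph, distinct vertices with a common neighbor are at distance two. -/
theorem dist_eq_two (hG : IsMedianGraph G) {x y z : V} (hxy : G.Adj x y)
    (hyz : G.Adj y z) (hxz : x ≠ z) : G.dist x z = 2 := by
  have hle : G.dist x z ≤ 2 := dist_le (.cons hxy (.cons hyz .nil))
  have hpos : 0 < G.dist x z := hG.1.pos_dist_of_ne hxz
  have hne : G.dist x z ≠ 1 := fun h =>
    hG.not_adj_of_adj_of_adj hxy hyz (dist_eq_one_iff_adj.mp h)
  omega

/-- A common neighbor of three distinct vertices of a median graph is their median. -/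
theorem isMedianVertex_of_adj (hG : IsMedianGraph G) {x y z m : V} (hx : G.Adj m x)
    (hy : G.Adj m y) (hz : G.Adj m z) (hxy : x ≠ y) (hyz : y ≠ z) (hxz : x ≠ z) :
    IsMedianVertex G x y z m := by
  simp only [IsMedianVertex, hG.dist_eq_two hx.symm hy hxy, hG.dist_eq_two hy.symm hz hyz,
    hG.dist_eq_two hx.symm hz hxz, dist_eq_one_iff_adj.mpr hx.symm,
    dist_eq_one_iff_adj.mpr hy.symm, dist_eq_one_iff_adj.mpr hy, dist_eq_one_iff_adj.mpr hz,
    Nat.reduceAdd, and_self]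

/-- In a median graph, distinct vertices have at most two common neighbors. -/
theorem eq_or_eq_of_common_neighbors (hG : IsMedianGraph G) {u v x y w : V} (huv : u ≠ v)
    (hxy : x ≠ y) (hux : G.Adj u x) (hvx : G.Adj v x) (huy : G.Adj u y) (hvy : G.Adj v y)
    (huw : G.Adj u w) (hvw : G.Adj v w) : w = x ∨ w = y := by
  by_contra! h
  exact huv ((hG.2 x y w).unique
    (hG.isMedianVertex_of_adj hux huy huw hxy h.2.symm h.1.symm)
    (hG.isMedianVertex_of_adj hvx hvy hvw hxy h.2.symm h.1.symm))

end IsMedianGraph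

/-- Distinct vertices of the 4-cycle are adjacent or have two distinct common neighbors. -/
theorem cycleGraph_four_adj_or_common_neighbors {i j : Fin 4} (hij : i ≠ j) :
    (cycleGraph 4).Adj i j ∨ ∃ k l, k ≠ l ∧ (cycleGraph 4).Adj i k ∧
      (cycleGraph 4).Adj j k ∧ (cycleGraph 4).Adj i l ∧ (cycleGraph 4).Adj j l := by
  revert i j hij
  decide

/-- Every 4-cycle of a median graph is a convex subgraph. -/
theorem median_square_convex {V : Type*} [Fintype V] (G : SimpleGraph V)
    (hG : IsMedianGraph G)
    (C : G.Subgraph) (hC : Nonempty (C.coe ≃g cycleGraph 4)) :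
    IsConvexSubgraph C := by
  obtain ⟨e⟩ := hC
  have key : ∀ u v : C.verts, u ≠ v → C.Adj u v ∨
      ∃ k l : V, k ≠ l ∧ C.Adj u k ∧ C.Adj v k ∧ C.Adj u l ∧ C.Adj v l := by
    intro u v huv
    have hadj : ∀ (a : C.verts) (k : Fin 4), (cycleGraph 4).Adj (e a) k →
        C.Adj a (e.symm k) := fun a k h => by
      have : C.coe.Adj a (e.symm k) := by
        rw [← e.map_adj_iff, RelIso.apply_symm_apply]
        exact h
      exact this
    rcases cycleGraph_four_adj_or_common_neighbors (e.injective.ne huv) with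
      h | ⟨k, l, hkl, h₁, h₂, h₃, h₄⟩
    · exact .inl (e.map_adj_iff.mp h)
    · exact .inr ⟨e.symm k, e.symm l,
        fun h => hkl (e.symm.injective (Subtype.ext h)),
        hadj u k h₁, hadj v k h₂, hadj u l h₃, hadj v l h₄⟩
  intro u v hu hv p _ hlen
  rcases eq_or_ne u v with rfl | huv
  · rw [SimpleGraph.dist_self] at hlen
    match p, hlen with
    | .nil, _ => simpa using hu
  rcases key ⟨u, hu⟩ ⟨v, hv⟩ (Subtype.coe_ne_coe.mp huv) with
    h | ⟨k, l, hkl, huk, hvk, hul, hvl⟩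
  · rw [dist_eq_one_iff_adj.mpr h.adj_sub] at hlen
    match p, hlen with
    | .cons _ .nil, _ => simpa [hv] using h
  · rw [hG.dist_eq_two huk.adj_sub hvk.adj_sub.symm huv] at hlen
    match p, hlen with
    | .cons (v := w) huw (.cons hwv .nil), _ =>
      have hw : C.Adj u w ∧ C.Adj w v := by
        rcases hG.eq_or_eq_of_common_neighbors huv hkl huk.adj_sub hvk.adj_sub hul.adj_sub
          hvl.adj_sub huw hwv.symm with rfl | rfl
        · exact ⟨huk, hvk.symm⟩
        · exact ⟨hul, hvl.symm⟩
      simpa [hv] using hw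
end
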